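/- arXiv:1003.6041 — 3 statements merged into one kernel-verified Lean document; each statement's English description precedes it below -/
import Mathlib

section
/- Let (A, ∂_A), (B, ∂_B), (C, ∂_C) be differential modules over 𝔽₂, let f₁ : A → B and f₂ : B → C be chain maps, and let H : A → C be a null-homotopy of f₂ ∘ f₁. Let A_{f₁,f₂} denote the differential module A ⊕ B ⊕ C with differential ∂(a, b, c) = (∂_A a, f₁(a) + ∂_B b, H(a) + f₂(b) + ∂_C c). If the homology H(A_{f₁,f₂}) vanishes, then the induced sequence H(A) → H(B) → H(C) is exact at H(B), i.e. ker (f₂)_* = im (f₁)_*. -/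
/-- The field with two elements. -/
abbrev F2 : Type := ZMod 2

/-- The homology of a differential module `(M, d)` over `𝔽₂`: cycles modulo boundaries. -/
abbrev DiffHomology {M : Type*} [AddCommGroup M] [Module F2 M] (d : M →ₗ[F2] M) : Type _ :=
  LinearMap.ker d ⧸ (LinearMap.range d).comap (LinearMap.ker d).subtype

/-- A chain map restricts to a map on cycles. -/
def cycleMap {A B : Type*} [AddCommGroup A] [Module F2 A] [AddCommGroup B] [Module F2 B]
    (dA : A →ₗ[F2] A) (dB : B →ₗ[F2] B) (f : A →ₗ[F2] B) (hf : f ∘ₗ dA = dB ∘ₗ f) :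
    LinearMap.ker dA →ₗ[F2] LinearMap.ker dB :=
  f.restrict (fun x hx => by
    have h := LinearMap.congr_fun hf x
    simp only [LinearMap.comp_apply] at h
    simp only [LinearMap.mem_ker] at hx ⊢
    rw [← h, hx, map_zero])

/-- The map induced on homology by a chain map between differential modules over `𝔽₂`. -/
def inducedMap {A B : Type*} [AddCommGroup A] [Module F2 A] [AddCommGroup B] [Module F2 B]
    (dA : A →ₗ[F2] A) (dB : B →ₗ[F2] B) (f : A →ₗ[F2] B) (hf : f ∘ₗ dA = dB ∘ₗ f) :
    DiffHomology dA →ₗ[F2] DiffHomology dB :=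
  Submodule.mapQ _ _ (cycleMap dA dB f hf) (by
    rintro ⟨x, hx⟩ hmem
    simp only [Submodule.mem_comap, Submodule.coe_subtype, LinearMap.mem_range] at hmem ⊢
    obtain ⟨y, hy⟩ := hmem
    refine ⟨f y, ?_⟩
    have h := LinearMap.congr_fun hf y
    simp only [LinearMap.comp_apply] at h
    simp only [cycleMap, LinearMap.restrict_coe_apply]
    rw [← h, hy])

/-- Let `(A, ∂_A)`, `(B, ∂_B)`, `(C, ∂_C)` be differential modules over `𝔽₂`,
`f₁ : A → B` and `f₂ : B → C` chain maps, and `H : A → C` a null-homotopy of `f₂ ∘ f₁`.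
Let `A_{f₁,f₂}` be the differential module `A ⊕ B ⊕ C` with differential
`∂(a, b, c) = (∂_A a, f₁(a) + ∂_B b, H(a) + f₂(b) + ∂_C c)`.  If the homology of `A_{f₁,f₂}`
vanishes, then the induced sequence `H(A) → H(B) → H(C)` is exact at `H(B)`,
i.e. `ker (f₂)_* = im (f₁)_*`. -/
theorem stmt1
    {A B C : Type*} [AddCommGroup A] [Module F2 A] [AddCommGroup B] [Module F2 B]
    [AddCommGroup C] [Module F2 C]
    (dA : A →ₗ[F2] A) (dB : B →ₗ[F2] B) (dC : C →ₗ[F2] C)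
    (hdA : dA ∘ₗ dA = 0) (hdB : dB ∘ₗ dB = 0) (hdC : dC ∘ₗ dC = 0)
    (f₁ : A →ₗ[F2] B) (f₂ : B →ₗ[F2] C)
    (hf₁ : f₁ ∘ₗ dA = dB ∘ₗ f₁) (hf₂ : f₂ ∘ₗ dB = dC ∘ₗ f₂)
    (H : A →ₗ[F2] C) (hH : f₂ ∘ₗ f₁ = dC ∘ₗ H + H ∘ₗ dA)
    (D : (A × B × C) →ₗ[F2] (A × B × C))
    (hD : ∀ a b c, D (a, b, c) = (dA a, f₁ a + dB b, H a + f₂ b + dC c))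
    (hvanish : ∀ x : DiffHomology D, x = 0) :
    LinearMap.ker (inducedMap dB dC f₂ hf₂) = LinearMap.range (inducedMap dA dB f₁ hf₁) := by
  ext x
  obtain ⟨⟨b, hb⟩, rfl⟩ := Submodule.mkQ_surjective _ x
  simp only [LinearMap.mem_ker, LinearMap.mem_range, inducedMap, Submodule.mkQ_apply,
    Submodule.mapQ_apply]
  rw [Submodule.Quotient.mk_eq_zero]
  simp only [Submodule.mem_comap, LinearMap.mem_range, Submodule.coe_subtype, cycleMap,
    LinearMap.coe_restrict_apply]
  constructor
  · rintro ⟨c, hc⟩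
    have hcycle : D (0, b, -c) = 0 := by
      rw [hD]
      simp [LinearMap.mem_ker.mp hb, hc]
    have hbdry := hvanish (Submodule.Quotient.mk ⟨(0, b, -c), hcycle⟩)
    rw [Submodule.Quotient.mk_eq_zero] at hbdry
    obtain ⟨⟨a, b', c'⟩, h⟩ := hbdry
    rw [hD] at h
    simp only [Submodule.coe_subtype, Prod.mk.injEq] at h
    obtain ⟨ha, hfa, -⟩ := h
    refine ⟨Submodule.Quotient.mk ⟨a, ha⟩, ?_⟩
    rw [Submodule.mapQ_apply, Submodule.Quotient.eq]
    refine ⟨-b', ?_⟩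
    simp [← hfa]
  · rintro ⟨y, hy⟩
    obtain ⟨⟨a, ha⟩, rfl⟩ := Submodule.mkQ_surjective _ y
    rw [Submodule.mkQ_apply, Submodule.mapQ_apply, Submodule.Quotient.eq] at hy
    obtain ⟨b', hb'⟩ := hy
    have hb' : dB b' = f₁ a - b := hb'
    have hHa := LinearMap.congr_fun hH a
    have hfb := LinearMap.congr_fun hf₂ b'
    simp only [LinearMap.comp_apply, LinearMap.add_apply, LinearMap.mem_ker.mp ha, map_zero,
      add_zero] at hHa hfb
    refine ⟨H a - f₂ b', ?_⟩
    rw [map_sub, ← hHa, ← hfb, hb', map_sub, sub_sub_cancel]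
end

section
/- Let (A, ∂_A), (B, ∂_B), (C, ∂_C) be differential modules over 𝔽₂, let f₁ : A → B and f₂ : B → C be chain maps, and let H : A → C be a null-homotopy of f₂ ∘ f₁. Let A_{f₁,f₂} be the differential module A ⊕ B ⊕ C with differential ∂(a, b, c) = (∂_A a, f₁(a) + ∂_B b, H(a) + f₂(b) + ∂_C c). Then H(A_{f₁,f₂}) = 0 if and only if the chain map (H, f₂) : M(f₁) → C, (a, b) ↦ H(a) + f₂(b), induces an isomorphism (H, f₂)_* : H(M(f₁)) → H(C). -/
/-- The homology of a differential module vanishes iff every cycle is a boundary. -/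
lemma diffHomology_eq_zero_iff {M : Type*} [AddCommGroup M] [Module F2 M] (d : M →ₗ[F2] M) :
    (∀ x : DiffHomology d, x = 0) ↔ ∀ x, d x = 0 → ∃ y, d y = x := by
  rw [(Submodule.mkQ_surjective _).forall]
  simp [Submodule.Quotient.mk_eq_zero]

/-- The induced map is injective iff every cycle whose image is a boundary is a boundary. -/
lemma inducedMap_injective_iff {A B : Type*} [AddCommGroup A] [Module F2 A] [AddCommGroup B]
    [Module F2 B] (dA : A →ₗ[F2] A) (dB : B →ₗ[F2] B) (f : A →ₗ[F2] B)
    (hf : f ∘ₗ dA = dB ∘ₗ f) :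
    Function.Injective (inducedMap dA dB f hf) ↔
      ∀ x, dA x = 0 → (∃ y, dB y = f x) → ∃ z, dA z = x := by
  rw [injective_iff_map_eq_zero, (Submodule.mkQ_surjective _).forall]
  simp [inducedMap, cycleMap, Submodule.Quotient.mk_eq_zero]

/-- The induced map is surjective iff every cycle is homologous to the image of a cycle. -/
lemma inducedMap_surjective_iff {A B : Type*} [AddCommGroup A] [Module F2 A] [AddCommGroup B]
    [Module F2 B] (dA : A →ₗ[F2] A) (dB : B →ₗ[F2] B) (f : A →ₗ[F2] B)
    (hf : f ∘ₗ dA = dB ∘ₗ f) :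
    Function.Surjective (inducedMap dA dB f hf) ↔
      ∀ y, dB y = 0 → ∃ x, dA x = 0 ∧ ∃ z, dB z = f x - y := by
  unfold Function.Surjective
  simp only [(Submodule.mkQ_surjective _).forall, (Submodule.mkQ_surjective _).exists]
  simp [inducedMap, cycleMap, Submodule.Quotient.eq]

/-- The mapping cone of a chain map is acyclic iff the chain map is a quasi-isomorphism. -/
lemma cone_acyclic_iff_inducedMap_bijective {M C : Type*} [AddCommGroup M] [Module F2 M]
    [AddCommGroup C] [Module F2 C] (d : M →ₗ[F2] M) (dC : C →ₗ[F2] C) (G : M →ₗ[F2] C)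
    (hG : G ∘ₗ d = dC ∘ₗ G) :
    (∀ m c, d m = 0 → G m + dC c = 0 → ∃ m' c', d m' = m ∧ G m' + dC c' = c) ↔
      Function.Bijective (inducedMap d dC G hG) := by
  rw [Function.Bijective, inducedMap_injective_iff, inducedMap_surjective_iff]
  have hG' (m : M) : G (d m) = dC (G m) := LinearMap.congr_fun hG m
  constructor
  · refine fun h => ⟨?_, fun y hy => ?_⟩
    · rintro x hx ⟨y, hy⟩
      obtain ⟨m, -, hm, -⟩ := h x (-y) hx (by simp [hy])
      exact ⟨m, hm⟩
    · obtain ⟨m, c, hm, hc⟩ := h 0 y (map_zero d) (by simp [hy])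
      exact ⟨m, hm, -c, by rw [← hc, map_neg]; abel⟩
  · rintro ⟨hinj, hsurj⟩ m c hm hc
    obtain ⟨m', rfl⟩ := hinj m hm ⟨-c, by rw [map_neg]; exact neg_eq_of_add_eq_zero_left hc⟩
    obtain ⟨x, hx, z, hz⟩ := hsurj (G m' + c) (by rw [map_add, ← hG', hc])
    refine ⟨m' - x, z, by simp [hx], ?_⟩
    rw [hz, map_sub]
    calc G m' - G x + (G x - (G m' + c)) = -c := by abel
      _ = c := ZModModule.neg_eq_self _

/-- Let `(A, ∂_A)`, `(B, ∂_B)`, `(C, ∂_C)` be differential modules over `𝔽₂`,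
`f₁ : A → B` and `f₂ : B → C` chain maps, and `H : A → C` a null-homotopy of `f₂ ∘ f₁`.
Let `A_{f₁,f₂}` be the differential module `A ⊕ B ⊕ C` with differential
`∂(a, b, c) = (∂_A a, f₁(a) + ∂_B b, H(a) + f₂(b) + ∂_C c)`.  Then `H(A_{f₁,f₂}) = 0` if and
only if the chain map `(H, f₂) : M(f₁) → C`, `(a, b) ↦ H(a) + f₂(b)`, from the mapping cone of
`f₁` induces an isomorphism `(H, f₂)_* : H(M(f₁)) → H(C)`. -/
theorem stmt3
    {A B C : Type*} [AddCommGroup A] [Module F2 A] [AddCommGroup B] [Module F2 B]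
    [AddCommGroup C] [Module F2 C]
    (dA : A →ₗ[F2] A) (dB : B →ₗ[F2] B) (dC : C →ₗ[F2] C)
    (hdA : dA ∘ₗ dA = 0) (hdB : dB ∘ₗ dB = 0) (hdC : dC ∘ₗ dC = 0)
    (f₁ : A →ₗ[F2] B) (f₂ : B →ₗ[F2] C)
    (hf₁ : f₁ ∘ₗ dA = dB ∘ₗ f₁) (hf₂ : f₂ ∘ₗ dB = dC ∘ₗ f₂)
    (H : A →ₗ[F2] C) (hH : f₂ ∘ₗ f₁ = dC ∘ₗ H + H ∘ₗ dA)
    (D : (A × B × C) →ₗ[F2] (A × B × C))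
    (hD : ∀ a b c, D (a, b, c) = (dA a, f₁ a + dB b, H a + f₂ b + dC c))
    (Dcone : (A × B) →ₗ[F2] (A × B))
    (hDcone : ∀ a b, Dcone (a, b) = (dA a, f₁ a + dB b))
    (G : (A × B) →ₗ[F2] C)
    (hG : ∀ a b, G (a, b) = H a + f₂ b)
    (hGchain : G ∘ₗ Dcone = dC ∘ₗ G) :
    (∀ x : DiffHomology D, x = 0) ↔
      Function.Bijective (inducedMap Dcone dC G hGchain) := by
  rw [← cone_acyclic_iff_inducedMap_bijective, diffHomology_eq_zero_iff]
  simp [hD, hDcone, hG, Prod.forall, Prod.exists, Prod.ext_iff, and_assoc]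
end

section
/- Let {(A_i, ∂_i)}_{i∈ℤ} be a collection of differential modules over 𝔽₂, let f_i : A_i → A_{i+1} be chain maps, and for each i let H_i : A_i → A_{i+2} be a null-homotopy of f_{i+1} ∘ f_i. Suppose that for every i the chain map ψ_i := f_{i+2} ∘ H_i + H_{i+1} ∘ f_i : A_i → A_{i+3} induces an isomorphism on homology. Then for every i the induced sequence H(A_i) → H(A_{i+1}) → H(A_{i+2}) is exact at H(A_{i+1}), i.e. im (f_i)_* = ker (f_{i+1})_*. -/
theorem DiffHomology.mk_eq_zero_iff {M : Type*} [AddCommGroup M] [Module F2 M]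
    {d : M →ₗ[F2] M} (x : LinearMap.ker d) :
    (Submodule.Quotient.mk x : DiffHomology d) = 0 ↔ ∃ b, d b = x := by
  rw [Submodule.Quotient.mk_eq_zero]
  simp

theorem inducedMap_mk {A B : Type*} [AddCommGroup A] [Module F2 A] [AddCommGroup B] [Module F2 B]
    {dA : A →ₗ[F2] A} {dB : B →ₗ[F2] B} {f : A →ₗ[F2] B} (hf : f ∘ₗ dA = dB ∘ₗ f)
    (x : LinearMap.ker dA) :
    inducedMap dA dB f hf (Submodule.Quotient.mk x)
      = Submodule.Quotient.mk (cycleMap dA dB f hf x) :=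
  rfl

theorem exists_boundary_of_inducedMap_injective {A B : Type*} [AddCommGroup A] [Module F2 A]
    [AddCommGroup B] [Module F2 B] {dA : A →ₗ[F2] A} {dB : B →ₗ[F2] B} {f : A →ₗ[F2] B}
    {hf : f ∘ₗ dA = dB ∘ₗ f} (h : Function.Injective (inducedMap dA dB f hf))
    {x : A} (hx : dA x = 0) {b : B} (hb : dB b = f x) : ∃ a, dA a = x := by
  refine (DiffHomology.mk_eq_zero_iff (⟨x, hx⟩ : LinearMap.ker dA)).1 (h ?_)
  rw [map_zero, inducedMap_mk, DiffHomology.mk_eq_zero_iff]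
  exact ⟨b, hb⟩

theorem exists_cycle_of_inducedMap_surjective {A B : Type*} [AddCommGroup A] [Module F2 A]
    [AddCommGroup B] [Module F2 B] {dA : A →ₗ[F2] A} {dB : B →ₗ[F2] B} {f : A →ₗ[F2] B}
    {hf : f ∘ₗ dA = dB ∘ₗ f} (h : Function.Surjective (inducedMap dA dB f hf))
    {y : B} (hy : dB y = 0) : ∃ x, dA x = 0 ∧ ∃ b, dB b = f x - y := by
  obtain ⟨q, hq⟩ := h (Submodule.Quotient.mk ⟨y, hy⟩)
  obtain ⟨x, rfl⟩ := Submodule.Quotient.mk_surjective _ q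
  rw [inducedMap_mk, ← sub_eq_zero, ← Submodule.Quotient.mk_sub,
    DiffHomology.mk_eq_zero_iff] at hq
  exact ⟨x, x.2, hq⟩

/-- Let `{(A_i, ∂_i)}_{i ∈ ℤ}` be differential modules over `𝔽₂`, `f_i` chain
maps and `H_i` null-homotopies of `f_{i+1} ∘ f_i`.  Suppose that for every `i` the chain map
`ψ_i := f_{i+2} ∘ H_i + H_{i+1} ∘ f_i : A_i → A_{i+3}` induces an isomorphism on homology.
Then for every `i` the induced sequence `H(A_i) → H(A_{i+1}) → H(A_{i+2})` is exact at
`H(A_{i+1})`, i.e. `im (f_i)_* = ker (f_{i+1})_*`. -/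
theorem stmt7
    (A : ℤ → Type*) [∀ i, AddCommGroup (A i)] [∀ i, Module F2 (A i)]
    (d : ∀ i, A i →ₗ[F2] A i)
    (hd : ∀ i, d i ∘ₗ d i = 0)
    (f : ∀ i, A i →ₗ[F2] A (i + 1))
    (hf : ∀ i, f i ∘ₗ d i = d (i + 1) ∘ₗ f i)
    (H : ∀ i, A i →ₗ[F2] A (i + 1 + 1))
    (hH : ∀ i, f (i + 1) ∘ₗ f i = d (i + 1 + 1) ∘ₗ H i + H i ∘ₗ d i)
    (hψchain : ∀ i, (f (i + 1 + 1) ∘ₗ H i + H (i + 1) ∘ₗ f i) ∘ₗ d i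
        = d (i + 1 + 1 + 1) ∘ₗ (f (i + 1 + 1) ∘ₗ H i + H (i + 1) ∘ₗ f i))
    (hψiso : ∀ i, Function.Bijective
        (inducedMap (d i) (d (i + 1 + 1 + 1))
          (f (i + 1 + 1) ∘ₗ H i + H (i + 1) ∘ₗ f i) (hψchain i))) :
    ∀ i, LinearMap.range (inducedMap (d i) (d (i + 1)) (f i) (hf i))
        = LinearMap.ker (inducedMap (d (i + 1)) (d (i + 1 + 1)) (f (i + 1)) (hf (i + 1))) := by
  intro i
  have hf' : ∀ j x, f j (d j x) = d (j + 1) (f j x) := fun j => LinearMap.congr_fun (hf j)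
  have hH' : ∀ j x, f (j + 1) (f j x) = d (j + 1 + 1) (H j x) + H j (d j x) :=
    fun j => LinearMap.congr_fun (hH j)
  ext q
  obtain ⟨⟨z, hz⟩, rfl⟩ := Submodule.Quotient.mk_surjective _ q
  rw [LinearMap.mem_ker, inducedMap_mk, DiffHomology.mk_eq_zero_iff, LinearMap.mem_range]
  rw [LinearMap.mem_ker] at hz
  constructor
  · rintro ⟨p, hp⟩
    obtain ⟨⟨x, hx⟩, rfl⟩ := Submodule.Quotient.mk_surjective _ p
    rw [LinearMap.mem_ker] at hx
    rw [inducedMap_mk, ← sub_eq_zero, ← Submodule.Quotient.mk_sub,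
      DiffHomology.mk_eq_zero_iff] at hp
    obtain ⟨b, hb⟩ := hp
    change d (i + 1) b = f i x - z at hb
    refine ⟨H i x - f (i + 1) b, ?_⟩
    change _ = f (i + 1) z
    rw [map_sub, ← hf', hb, map_sub, hH', hx, map_zero]
    abel
  · rintro ⟨w, hw⟩
    change d (i + 1 + 1) w = f (i + 1) z at hw
    have hy : d (i + 1 + 1 + 1) (H (i + 1) z + f (i + 1 + 1) w) = 0 := by
      have h := hH' (i + 1) z
      rw [hz, map_zero, add_zero] at h
      rw [map_add, ← hf', hw, ← h, ZModModule.add_self]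
    obtain ⟨x, hx, b, hb⟩ := exists_cycle_of_inducedMap_surjective (hψiso i).2 hy
    have hfx : d (i + 1) (f i x - z) = 0 := by rw [map_sub, ← hf', hx, hz, map_zero, sub_zero]
    have hbound : d (i + 1 + 1 + 1 + 1)
        (H (i + 1 + 1) w + f (i + 1 + 1 + 1) b - H (i + 1 + 1) (H i x))
        = (f (i + 1 + 1 + 1) ∘ₗ H (i + 1) + H (i + 1 + 1) ∘ₗ f (i + 1)) (f i x - z) := by
      have h₁ := hH' (i + 1 + 1) w
      have h₂ := hH' (i + 1 + 1) (H i x)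
      have h₃ := hH' i x
      rw [hx, map_zero, add_zero] at h₃
      simp only [LinearMap.add_apply, LinearMap.comp_apply, map_add, map_sub] at hb ⊢
      rw [← hf', hb, h₃, ← hw]
      simp only [map_add, map_sub]
      rw [h₁, h₂]
      abel
    obtain ⟨c, hc⟩ := exists_boundary_of_inducedMap_injective (hψiso (i + 1)).1 hfx hbound
    refine ⟨Submodule.Quotient.mk ⟨x, hx⟩, ?_⟩
    rw [inducedMap_mk, ← sub_eq_zero, ← Submodule.Quotient.mk_sub, DiffHomology.mk_eq_zero_iff]
    exact ⟨c, hc⟩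
end
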